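/- arXiv:1509.01894 — 4 statements merged into one kernel-verified Lean document; each statement's English description precedes it below -/
import Mathlib

section
/- Let s > 0 and let C ∈ (1/2, 1] satisfy (1 − C)²/(2C − 1) ≤ 1. Let (a_k)_{k ≥ 0} be a sequence of real numbers such that a₀ ≥ −C/s, such that 1 + s·a_k > 0 for all k ≥ 0, and such that for every k ≥ 1 one has 1 − 4 s a_{k−1} ≥ 0 and (s a_k)/(1 + s a_k) ≥ (1 − √(1 − 4 s a_{k−1}))/2. Then a_k ≥ −C/(s(k+1)) for all k ≥ 0. -/
/-- A real number `y ≥ -C/m` satisfies `√(1 - 4y) ≤ 1 + 2C/(m + 1 - C)` as soon as `m ≥ 1` and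
`(1 - C)² ≤ 2C - 1`. -/
theorem sqrt_one_sub_four_mul_le {C m y : ℝ} (hC₁ : 1 / 2 < C) (hC₂ : C ≤ 1)
    (hC : (1 - C) ^ 2 ≤ 2 * C - 1) (hm : 1 ≤ m) (hy : -C / m ≤ y) :
    Real.sqrt (1 - 4 * y) ≤ 1 + 2 * (C / (m + 1 - C)) := by
  have hm0 : 0 < m := by linarith
  have hd : 0 < m + 1 - C := by linarith
  have key : (m + 1 - C) ^ 2 ≤ m * (m + 1) := by nlinarith
  have hfrac : C / m ≤ C * (m + 1) / (m + 1 - C) ^ 2 := by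
    rw [div_le_div_iff₀ hm0 (by positivity)]
    nlinarith
  have hsq : (1 + 2 * (C / (m + 1 - C))) ^ 2 = 1 + 4 * (C * (m + 1) / (m + 1 - C) ^ 2) := by
    field_simp
    ring
  rw [Real.sqrt_le_left (by positivity), hsq]
  rw [neg_div] at hy
  linarith

/-- One step of the recursion, for the rescaled quantities `y = s a_{k-1}` and `x = s a_k`. -/
theorem neg_div_succ_le_of_sqrt_step {C m x y : ℝ} (hC₁ : 1 / 2 < C) (hC₂ : C ≤ 1)
    (hC : (1 - C) ^ 2 ≤ 2 * C - 1) (hm : 1 ≤ m) (hy : -C / m ≤ y) (hx : 0 < 1 + x)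
    (hstep : (1 - Real.sqrt (1 - 4 * y)) / 2 ≤ x / (1 + x)) :
    -C / (m + 1) ≤ x := by
  have hd : 0 < m + 1 - C := by linarith
  have hle : -C / (m + 1 - C) ≤ x / (1 + x) := by
    rw [neg_div]
    linarith [sqrt_one_sub_four_mul_le hC₁ hC₂ hC hm hy]
  rw [div_le_div_iff₀ hd hx] at hle
  rw [div_le_iff₀ (by linarith)]
  linarith


/-- Discrete Harnack-type recursion: if the sequence `a k` (the infimum of the Hessian of
`log ρ_k^N` over the unit sphere bundle) satisfies the one-step recursive inequality coming
from the JKO scheme with time step `s = K/N`, then `a k ≥ -C/(s(k+1))` for all `k`. -/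
theorem jko_recursive_harnack_bound (s : ℝ) (hs : 0 < s) (C : ℝ)
    (hC₁ : 1 / 2 < C) (hC₂ : C ≤ 1) (hC₃ : (1 - C) ^ 2 / (2 * C - 1) ≤ 1)
    (a : ℕ → ℝ) (h0 : a 0 ≥ -C / s) (hpos : ∀ k, 0 < 1 + s * a k)
    (hrec : ∀ k, 1 ≤ k → 1 - 4 * s * a (k - 1) ≥ 0 ∧
      (s * a k) / (1 + s * a k) ≥ (1 - Real.sqrt (1 - 4 * s * a (k - 1))) / 2) :
    ∀ k : ℕ, a k ≥ -C / (s * (k + 1)) := by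
  have hC : (1 - C) ^ 2 ≤ 2 * C - 1 := by
    rwa [div_le_one (by linarith)] at hC₃
  have hscaled : ∀ k : ℕ, -C / ((k : ℝ) + 1) ≤ s * a k := by
    intro k
    induction k with
    | zero =>
      rw [ge_iff_le, div_le_iff₀ hs] at h0
      simpa [mul_comm s] using h0
    | succ k ih =>
      have hstep := (hrec (k + 1) k.succ_pos).2
      rw [Nat.add_sub_cancel, mul_assoc] at hstep
      push_cast
      exact neg_div_succ_le_of_sqrt_step hC₁ hC₂ hC (by simp) ih (hpos (k + 1)) hstep
  intro k
  rw [ge_iff_le, mul_comm, ← div_div, div_le_iff₀ hs, mul_comm]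
  exact hscaled k
end

section
/- Let C be a real number with 1/2 < C ≤ 1 and let k ≥ 1 be a real number. Then (1 − √(1 + 4C/k)) / (1 + √(1 + 4C/k)) ≥ −C/(k+1) if and only if k ≥ (1 − C)²/(2C − 1). -/
/-- For `1/2 < C ≤ 1` and `k ≥ 1`, the inequality
`(1 − √(1 + 4C/k)) / (1 + √(1 + 4C/k)) ≥ −C/(k+1)` holds iff `k ≥ (1 − C)²/(2C − 1)`. -/
theorem sqrt_ratio_ge_iff (C k : ℝ) (hC₁ : 1 / 2 < C) (hC₂ : C ≤ 1) (hk : 1 ≤ k) :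
    (1 - Real.sqrt (1 + 4 * C / k)) / (1 + Real.sqrt (1 + 4 * C / k)) ≥ -C / (k + 1) ↔
      k ≥ (1 - C) ^ 2 / (2 * C - 1) := by
  have hk0 : 0 < k := by linarith
  have hd : 0 < k + 1 - C := by linarith
  have hs : 0 ≤ Real.sqrt (1 + 4 * C / k) := Real.sqrt_nonneg _
  have ratio_iff : (1 - Real.sqrt (1 + 4 * C / k)) / (1 + Real.sqrt (1 + 4 * C / k)) ≥
      -C / (k + 1) ↔ Real.sqrt (1 + 4 * C / k) ≤ (k + 1 + C) / (k + 1 - C) := by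
    rw [ge_iff_le, div_le_div_iff₀ (by linarith) (by linarith), le_div_iff₀ hd]
    constructor <;> intro h <;> linarith
  have sq_sub : ((k + 1 + C) / (k + 1 - C)) ^ 2 - (1 + 4 * C / k) =
      4 * C / (k * (k + 1 - C) ^ 2) * (k * (2 * C - 1) - (1 - C) ^ 2) := by
    field_simp
    ring
  have hpos : 0 < 4 * C / (k * (k + 1 - C) ^ 2) := by
    have : 0 < C := by linarith
    positivity
  rw [ratio_iff, Real.sqrt_le_left (div_nonneg (by linarith) hd.le), ← sub_nonneg, sq_sub,
    mul_nonneg_iff_of_pos_left hpos, sub_nonneg, ge_iff_le, div_le_iff₀ (by linarith)]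
end

section
/- Let (X, d) be a metric space, x, y ∈ X, and γ : [0,1] → X a curve with γ(0) = x, γ(1) = y and d(γ(s), γ(t)) = |s − t|·d(x, y) for all s, t ∈ [0,1]. Let s > 0, C ∈ [0,1], n ≥ 1 an integer, and let 1 ≤ k₁ ≤ k₂ be integers. Suppose ρ_{k₁−1}, ρ_{k₁}, …, ρ_{k₂} : X → (0, ∞) are functions satisfying, for every integer k with k₁ ≤ k ≤ k₂ and all a, b ∈ X, ρ_{k−1}(a) ≤ ((k+1)/(k+1−C))^n · exp( d(a, b)² / (2 s) ) · ρ_k(b). Then ρ_{k₁−1}(x) ≤ ((k₂+1)/(k₁+1−C))^n · exp( d(x, y)² / (2 (k₂ − k₁ + 1) s) ) · ρ_{k₂}(y). -/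
/-- Chaining one-step Harnack inequalities along a discrete path with steps of equal length `δ`. -/
theorem chain_harnack_along_equal_steps {X : Type*} [PseudoMetricSpace X]
    {s C δ : ℝ} (hC₁ : C ≤ 1) {n j : ℕ} {ρ : ℕ → X → ℝ} {p : ℕ → X} (m : ℕ)
    (hρ : ∀ k, k ≤ j + m + 1 → j ≤ k → ∀ a, 0 ≤ ρ k a)
    (hstep : ∀ k, j ≤ k → k ≤ j + m → ∀ a b : X,
      ρ k a ≤ (((k : ℝ) + 2) / ((k : ℝ) + 2 - C)) ^ n *
        Real.exp (dist a b ^ 2 / (2 * s)) * ρ (k + 1) b)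
    (hp : ∀ i ≤ m, dist (p i) (p (i + 1)) = δ) :
    ρ j (p 0) ≤ (((j : ℝ) + m + 2) / ((j : ℝ) + 2 - C)) ^ n *
      Real.exp (((m : ℝ) + 1) * (δ ^ 2 / (2 * s))) * ρ (j + m + 1) (p (m + 1)) := by
  induction m with
  | zero => simpa [hp 0 le_rfl] using hstep j le_rfl le_rfl (p 0) (p 1)
  | succ m ih =>
    have h₁ := ih (fun k hk => hρ k (by omega)) (fun k hj hk => hstep k hj (by omega))
      (fun i hi => hp i (by omega))
    have h₂ := hstep (j + m + 1) (by omega) (by omega) (p (m + 1)) (p (m + 1 + 1))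
    rw [hp (m + 1) le_rfl] at h₂
    have hj : (0 : ℝ) ≤ j := j.cast_nonneg
    have hm : (0 : ℝ) ≤ m := m.cast_nonneg
    have hpos : 0 < (j : ℝ) + 2 - C := by linarith
    have hpos' : 0 < (j : ℝ) + m + 3 - C := by linarith
    have hratio : ((j : ℝ) + m + 2) / (j + 2 - C) * ((j + m + 3) / (j + m + 3 - C)) ≤
        (j + m + 3) / (j + 2 - C) := by
      rw [div_mul_div_comm, div_le_div_iff₀ (by positivity) hpos]
      have : 0 ≤ ((j : ℝ) + m + 3) * (j + 2 - C) * (1 - C) :=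
        mul_nonneg (by positivity) (by linarith)
      linarith
    have hcast : ((j + m + 1 : ℕ) : ℝ) + 2 = j + m + 3 := by push_cast; ring
    rw [hcast] at h₂
    have hlast : 0 ≤ ρ (j + m + 1 + 1) (p (m + 1 + 1)) := hρ _ (by omega) (by omega) _
    calc ρ j (p 0)
        ≤ (((j : ℝ) + m + 2) / (j + 2 - C)) ^ n * Real.exp ((m + 1) * (δ ^ 2 / (2 * s))) *
            ρ (j + m + 1) (p (m + 1)) := h₁
      _ ≤ (((j : ℝ) + m + 2) / (j + 2 - C)) ^ n * Real.exp ((m + 1) * (δ ^ 2 / (2 * s))) *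
            ((((j : ℝ) + m + 3) / (j + m + 3 - C)) ^ n * Real.exp (δ ^ 2 / (2 * s)) *
              ρ (j + m + 1 + 1) (p (m + 1 + 1))) := by gcongr
      _ = (((j : ℝ) + m + 2) / (j + 2 - C) * ((j + m + 3) / (j + m + 3 - C))) ^ n *
            Real.exp ((m + 1 + 1) * (δ ^ 2 / (2 * s))) *
              ρ (j + m + 1 + 1) (p (m + 1 + 1)) := by
        rw [add_one_mul ((m : ℝ) + 1), Real.exp_add, mul_pow]
        ring
      _ ≤ (((j : ℝ) + m + 3) / (j + 2 - C)) ^ n *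
            Real.exp ((m + 1 + 1) * (δ ^ 2 / (2 * s))) *
              ρ (j + m + 1 + 1) (p (m + 1 + 1)) := by gcongr
      _ = _ := by push_cast; ring_nf


/-- Chaining one-step Harnack inequalities along a constant-speed minimizing geodesic
from `x` to `y`. -/
theorem chain_harnack_along_geodesic {X : Type*} [MetricSpace X] (x y : X)
    (γ : ℝ → X) (hγ₀ : γ 0 = x) (hγ₁ : γ 1 = y)
    (hgeo : ∀ s t : ℝ, s ∈ Set.Icc (0 : ℝ) 1 → t ∈ Set.Icc (0 : ℝ) 1 →
      dist (γ s) (γ t) = |s - t| * dist x y)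
    (s : ℝ) (hs : 0 < s) (C : ℝ) (hC₀ : 0 ≤ C) (hC₁ : C ≤ 1)
    (n : ℕ) (hn : 1 ≤ n) (k₁ k₂ : ℕ) (hk₁ : 1 ≤ k₁) (hk : k₁ ≤ k₂)
    (ρ : ℕ → X → ℝ) (hρpos : ∀ k, k₁ - 1 ≤ k → k ≤ k₂ → ∀ a, 0 < ρ k a)
    (hstep : ∀ k, k₁ ≤ k → k ≤ k₂ → ∀ a b : X,
      ρ (k - 1) a ≤ (((k : ℝ) + 1) / ((k : ℝ) + 1 - C)) ^ n *
        Real.exp (dist a b ^ 2 / (2 * s)) * ρ k b) :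
    ρ (k₁ - 1) x ≤ (((k₂ : ℝ) + 1) / ((k₁ : ℝ) + 1 - C)) ^ n *
      Real.exp (dist x y ^ 2 / (2 * ((k₂ : ℝ) - (k₁ : ℝ) + 1) * s)) * ρ k₂ y := by
  obtain ⟨j, rfl⟩ := Nat.exists_eq_add_of_le' hk₁
  obtain ⟨m, rfl⟩ := Nat.exists_eq_add_of_le hk
  have hm : (0 : ℝ) < (m : ℝ) + 1 := by positivity
  have hchain := chain_harnack_along_equal_steps (s := s) (δ := dist x y / ((m : ℝ) + 1)) (n := n)
    (j := j) (ρ := ρ) (p := fun i => γ ((i : ℝ) / ((m : ℝ) + 1))) hC₁ m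
    (fun k hk hjk a => (hρpos k (by omega) (by omega) a).le)
    (fun k hjk hk a b => by
      have h := hstep (k + 1) (by omega) (by omega) a b
      have hcast : ((k + 1 : ℕ) : ℝ) + 1 = k + 2 := by push_cast; ring
      rwa [hcast] at h)
    (fun i hi => by
      have hi' : (i : ℝ) ≤ m := by exact_mod_cast hi
      have hsub : (i : ℝ) / (m + 1) - ((i + 1 : ℕ) : ℝ) / (m + 1) = -(1 / (m + 1)) := by
        push_cast; ring
      rw [hgeo _ _ ⟨by positivity, by rw [div_le_one hm]; linarith⟩
        ⟨by positivity, by rw [div_le_one hm]; push_cast; linarith⟩, hsub, abs_neg,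
        abs_of_pos (by positivity)]
      ring)
  have hend : ((m + 1 : ℕ) : ℝ) / (m + 1) = 1 := by
    push_cast
    exact div_self hm.ne'
  simp only [Nat.cast_zero, zero_div, hend, hγ₀, hγ₁] at hchain
  have hexp : ((m : ℝ) + 1) * ((dist x y / (m + 1)) ^ 2 / (2 * s)) =
      dist x y ^ 2 / (2 * (((j + 1 + m : ℕ) : ℝ) - ((j + 1 : ℕ) : ℝ) + 1) * s) := by
    have hcount : ((j + 1 + m : ℕ) : ℝ) - ((j + 1 : ℕ) : ℝ) + 1 = m + 1 := by push_cast; ring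
    rw [hcount]
    field_simp
  have hnum : ((j + 1 + m : ℕ) : ℝ) + 1 = j + m + 2 := by push_cast; ring
  have hden : ((j + 1 : ℕ) : ℝ) + 1 = j + 2 := by push_cast; ring
  rw [← hexp, hnum, hden, Nat.add_sub_cancel, Nat.add_right_comm j 1 m]
  exact hchain
end

section
/- Let h : ℝ^n → ℝ be a smooth function, and suppose that for each t ∈ [0,1] the map ψ_t(x) = x + t ∇h(x) is a bijection of ℝ^n whose differential I + t ∇²h(x) is invertible for all x. Define g : [0,1] × ℝ^n → ℝ by g(t, ψ_t(x)) = h(x) + (t/2)|∇h(x)|². Then g is well defined and continuously differentiable, satisfies the Hamilton–Jacobi equation ∂_t g + ½|∇g|² = 0 on [0,1] × ℝ^n with g(0, ·) = h, and moreover ∇g(t, ψ_t(x)) = ∇h(x) for all t ∈ [0,1] and x ∈ ℝ^n. -/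
noncomputable section

abbrev Eu (n : ℕ) : Type := EuclideanSpace ℝ (Fin n)

open Set Filter Topology InnerProductSpace

/-- If `u ∘ f` agrees on `f ⁻¹' s` with a `C¹` function `F`, and `f` is `C¹` with invertible
derivative at `a`, then `u` is `C¹` within `s` at `f a`, with the derivative given by the chain
rule. -/
theorem contDiffWithinAt_and_hasFDerivWithinAt_of_comp_eq
    {X Y Z : Type*} [NormedAddCommGroup X] [NormedSpace ℝ X] [CompleteSpace X]
    [NormedAddCommGroup Y] [NormedSpace ℝ Y] [NormedAddCommGroup Z] [NormedSpace ℝ Z]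
    {f : X → Y} {F : X → Z} {u : Y → Z} {s : Set Y} {a : X} {e : X ≃L[ℝ] Y} {L : Y →L[ℝ] Z}
    (hf : ContDiffAt ℝ 1 f a) (hf' : HasFDerivAt f (e : X →L[ℝ] Y) a)
    (hF : ContDiffAt ℝ 1 F a) (hF' : HasFDerivAt F (L ∘L (e : X →L[ℝ] Y)) a)
    (ha : f a ∈ s) (hu : ∀ p, f p ∈ s → u (f p) = F p) :
    ContDiffWithinAt ℝ 1 u s (f a) ∧ HasFDerivWithinAt u L s (f a) := by
  have hs : HasStrictFDerivAt f (e : X →L[ℝ] Y) a := hf.hasStrictFDerivAt' hf' one_ne_zero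
  have hinv : hs.localInverse f e a (f a) = a := hs.localInverse_apply_image
  have heq : u =ᶠ[𝓝[s] f a] F ∘ hs.localInverse f e a := by
    filter_upwards [nhdsWithin_le_nhds hs.eventually_right_inverse, self_mem_nhdsWithin]
      with y hy hys
    have := hu (hs.localInverse f e a y) (by rwa [hy])
    rwa [hy] at this
  have heq' := heq.self_of_nhdsWithin ha
  constructor
  · refine ContDiffWithinAt.congr_of_eventuallyEq ?_ heq heq'
    refine (ContDiffAt.comp _ (by rwa [hinv]) ?_).contDiffWithinAt
    exact hf.to_localInverse hf' one_ne_zero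
  · refine HasFDerivWithinAt.congr_of_eventuallyEq ?_ heq heq'
    have h1 : HasFDerivAt F (L ∘L (e : X →L[ℝ] Y)) (hs.localInverse f e a (f a)) := by
      rwa [hinv]
    have h2 := h1.comp (f a) hs.to_localInverse.hasFDerivAt
    have h3 : (L ∘L (e : X →L[ℝ] Y)) ∘L (e.symm : Y →L[ℝ] X) = L := by ext; simp
    rw [h3] at h2
    exact h2.hasFDerivWithinAt

theorem ContDiff.gradient {E : Type*} [NormedAddCommGroup E] [InnerProductSpace ℝ E]
    [CompleteSpace E] {f : E → ℝ} {m n : WithTop ℕ∞} (hf : ContDiff ℝ n f) (hmn : m + 1 ≤ n) :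
    ContDiff ℝ m (gradient f) :=
  ((toDual ℝ E).symm : StrongDual ℝ E ≃ₗᵢ[ℝ] E).contDiff.comp (hf.fderiv_right hmn)

section Characteristics

variable {E : Type*} [NormedAddCommGroup E] [InnerProductSpace ℝ E] {t : ℝ} {x : E}

theorem hasFDerivAt_characteristicFlow {G : E → E} {D : E →L[ℝ] E} (hG : HasFDerivAt G D x) :
    HasFDerivAt (fun p : ℝ × E => (p.1, p.2 + p.1 • G p.2))
      ((ContinuousLinearMap.fst ℝ ℝ E).prod (ContinuousLinearMap.snd ℝ ℝ E +
        (t • D ∘L ContinuousLinearMap.snd ℝ ℝ E +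
          (ContinuousLinearMap.fst ℝ ℝ E).smulRight (G x)))) (t, x) := by
  have h1 : HasFDerivAt (fun p : ℝ × E => G p.2) (D ∘L ContinuousLinearMap.snd ℝ ℝ E) (t, x) :=
    HasFDerivAt.comp (t, x) hG hasFDerivAt_snd
  exact hasFDerivAt_fst.prodMk (hasFDerivAt_snd.add (hasFDerivAt_fst.smul h1))

theorem bijective_fderiv_characteristicFlow {D : E →L[ℝ] E} {v : E}
    (hD : Function.Bijective fun w => w + t • D w) :
    Function.Bijective ((ContinuousLinearMap.fst ℝ ℝ E).prod (ContinuousLinearMap.snd ℝ ℝ E +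
        (t • D ∘L ContinuousLinearMap.snd ℝ ℝ E +
          (ContinuousLinearMap.fst ℝ ℝ E).smulRight v))) := by
  constructor
  · rintro ⟨a, w⟩ ⟨b, z⟩ hab
    simp only [ContinuousLinearMap.prod_apply, add_apply,
      ContinuousLinearMap.coe_fst', ContinuousLinearMap.coe_snd', smul_apply,
      ContinuousLinearMap.comp_apply, ContinuousLinearMap.smulRight_apply, Prod.mk.injEq] at hab
    obtain ⟨rfl, hwz⟩ := hab
    rw [← add_assoc, ← add_assoc, add_left_inj] at hwz
    rw [hD.1 hwz]
  · rintro ⟨a, w⟩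
    obtain ⟨z, hz⟩ := hD.2 (w - a • v)
    refine ⟨(a, z), ?_⟩
    simp [← add_assoc, hz]

theorem hasFDerivAt_characteristicValue [CompleteSpace E] {h : E → ℝ} {D : E →L[ℝ] E}
    (hh : DifferentiableAt ℝ h x) (hG : HasFDerivAt (gradient h) D x) :
    HasFDerivAt (fun p : ℝ × E => h p.2 + p.1 / 2 * ‖gradient h p.2‖ ^ 2)
      ((innerSL ℝ (gradient h x) ∘L ContinuousLinearMap.snd ℝ ℝ E -
          (1 / 2 * ‖gradient h x‖ ^ 2) • ContinuousLinearMap.fst ℝ ℝ E) ∘L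
        ((ContinuousLinearMap.fst ℝ ℝ E).prod (ContinuousLinearMap.snd ℝ ℝ E +
        (t • D ∘L ContinuousLinearMap.snd ℝ ℝ E +
          (ContinuousLinearMap.fst ℝ ℝ E).smulRight (gradient h x))))) (t, x) := by
  have h1 : HasFDerivAt (fun p : ℝ × E => gradient h p.2)
      (D ∘L ContinuousLinearMap.snd ℝ ℝ E) (t, x) :=
    HasFDerivAt.comp (g := gradient h) (f := Prod.snd) (t, x) hG hasFDerivAt_snd
  have h2 : HasFDerivAt (fun p : ℝ × E => h p.2)
      (toDual ℝ E (gradient h x) ∘L ContinuousLinearMap.snd ℝ ℝ E) (t, x) :=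
    HasFDerivAt.comp (t, x) hh.hasGradientAt.hasFDerivAt hasFDerivAt_snd
  have h3 : HasFDerivAt (fun p : ℝ × E => p.1 / 2)
      ((2 : ℝ)⁻¹ • ContinuousLinearMap.fst ℝ ℝ E) (t, x) := by
    simpa only [div_eq_mul_inv] using (hasFDerivAt_fst (𝕜 := ℝ) (p := (t, x))).mul_const (2 : ℝ)⁻¹
  refine (h2.add (h3.mul h1.norm_sq)).congr_fderiv ?_
  ext p
  · simp
    ring
  · simp [inner_add_right, inner_smul_right]
    ring

end Characteristics

/-- Method of characteristics: if `h` is smooth and, for each `t ∈ [0,1]`, the map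
`ψ_t(x) = x + t∇h(x)` is a bijection with invertible differential `I + t∇²h(x)`, then the
function `g` defined by `g(t, ψ_t(x)) = h(x) + (t/2)|∇h(x)|²` is well defined, is `C¹` on
`[0,1] × ℝⁿ`, solves the Hamilton–Jacobi equation `∂_t g + ½|∇g|² = 0` with `g(0,·) = h`,
and satisfies `∇g(t, ψ_t(x)) = ∇h(x)`. -/
theorem hamilton_jacobi_characteristics (n : ℕ) (h : Eu n → ℝ) (hh : ContDiff ℝ (⊤ : ℕ∞) h)
    (ψ : ℝ → Eu n → Eu n) (hψ : ∀ t x, ψ t x = x + t • gradient h x)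
    (hbij : ∀ t ∈ Set.Icc (0 : ℝ) 1, Function.Bijective (ψ t))
    (hinv : ∀ t ∈ Set.Icc (0 : ℝ) 1, ∀ x : Eu n,
      Function.Bijective (fun v => v + t • fderiv ℝ (gradient h) x v))
    (g : ℝ → Eu n → ℝ)
    (hg : ∀ t ∈ Set.Icc (0 : ℝ) 1, ∀ x : Eu n,
      g t (ψ t x) = h x + (t / 2) * ‖gradient h x‖ ^ 2) :
    (∀ x, g 0 x = h x) ∧
      ContDiffOn ℝ 1 (fun p : ℝ × Eu n => g p.1 p.2) (Set.Icc (0 : ℝ) 1 ×ˢ Set.univ) ∧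
      (∀ t ∈ Set.Icc (0 : ℝ) 1, ∀ x : Eu n,
        HasDerivWithinAt (fun τ => g τ x) (-(1 / 2) * ‖gradient (g t) x‖ ^ 2)
          (Set.Icc (0 : ℝ) 1) t) ∧
      (∀ t ∈ Set.Icc (0 : ℝ) 1, ∀ x : Eu n, gradient (g t) (ψ t x) = gradient h x) := by
  have hG : ContDiff ℝ 1 (gradient h) := hh.gradient (by norm_cast)
  have hdG : ∀ x, HasFDerivAt (gradient h) (fderiv ℝ (gradient h) x) x := fun x =>
    (hG.differentiable one_ne_zero x).hasFDerivAt
  have h1 : ContDiff ℝ 1 h := hh.of_le (by norm_cast)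
  have key : ∀ t ∈ Set.Icc (0 : ℝ) 1, ∀ x,
      ContDiffWithinAt ℝ 1 (fun p : ℝ × Eu n => g p.1 p.2) (Set.Icc (0 : ℝ) 1 ×ˢ Set.univ)
        (t, ψ t x) ∧
      HasFDerivWithinAt (fun p : ℝ × Eu n => g p.1 p.2)
        (innerSL ℝ (gradient h x) ∘L ContinuousLinearMap.snd ℝ ℝ (Eu n) -
          (1 / 2 * ‖gradient h x‖ ^ 2) • ContinuousLinearMap.fst ℝ ℝ (Eu n))
        (Set.Icc (0 : ℝ) 1 ×ˢ Set.univ) (t, ψ t x) := by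
    intro t ht x
    have hb := bijective_fderiv_characteristicFlow (v := gradient h x) (hinv t ht x)
    let e := ContinuousLinearEquiv.ofBijective _ (LinearMap.ker_eq_bot.mpr hb.1)
      (LinearMap.range_eq_top.mpr hb.2)
    rw [hψ]
    refine contDiffWithinAt_and_hasFDerivWithinAt_of_comp_eq (a := (t, x)) (e := e)
      (f := fun p : ℝ × Eu n => (p.1, p.2 + p.1 • gradient h p.2))
      (F := fun p : ℝ × Eu n => h p.2 + p.1 / 2 * ‖gradient h p.2‖ ^ 2)
      ?_ (hasFDerivAt_characteristicFlow (hdG x)) ?_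
      (hasFDerivAt_characteristicValue (h1.differentiable one_ne_zero x) (hdG x))
      ⟨ht, Set.mem_univ _⟩ ?_
    · exact (contDiff_fst.prodMk
        (contDiff_snd.add (contDiff_fst.smul (hG.comp contDiff_snd)))).contDiffAt
    · exact ((h1.comp contDiff_snd).add ((contDiff_fst.div_const 2).mul
        ((hG.comp contDiff_snd).norm_sq ℝ))).contDiffAt
    · intro p hp
      simpa only [hψ] using hg p.1 hp.1 p.2
  have hgrad : ∀ t ∈ Set.Icc (0 : ℝ) 1, ∀ x : Eu n,
      gradient (g t) (ψ t x) = gradient h x := by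
    intro t ht x
    have h2 := (key t ht x).2.comp_hasFDerivAt (f := fun y => (t, y)) (ψ t x)
      (hasFDerivAt_prodMk_right t (ψ t x)) (Eventually.of_forall fun y => ⟨ht, Set.mem_univ y⟩)
    refine HasGradientAt.gradient (hasGradientAt_iff_hasFDerivAt.mpr (h2.congr_fderiv ?_))
    ext v
    simp
  refine ⟨fun x => ?_, ?_, ?_, hgrad⟩
  · simpa [hψ] using hg 0 (by simp) x
  · rintro ⟨t, y⟩ ⟨ht, -⟩
    obtain ⟨x, rfl⟩ := (hbij t ht).2 y
    exact (key t ht x).1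
  · intro t ht y
    obtain ⟨x, rfl⟩ := (hbij t ht).2 y
    rw [hgrad t ht x]
    have h2 := (key t ht x).2.comp (f := fun τ => (τ, ψ t x)) (s := Set.Icc (0 : ℝ) 1) t
      (hasFDerivAt_prodMk_left t (ψ t x)).hasFDerivWithinAt (fun τ hτ => ⟨hτ, Set.mem_univ _⟩)
    refine h2.hasDerivWithinAt.congr_deriv ?_
    simp
end
end
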